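/- arXiv:2306.10193 — 3 statements merged into one kernel-verified Lean document; each statement's English description precedes it below -/
import Mathlib

section
/- Let V_1, ..., V_{n+1} be exchangeable real-valued random variables. For ε ∈ (0,1), define q to be the ⌈(1-ε)(n+1)⌉-th smallest value among V_1, ..., V_n, taken to be +∞ if ⌈(1-ε)(n+1)⌉ > n (i.e., q = Quantile(1-ε; V_{1:n} ∪ {∞})). Then ℙ(V_{n+1} ≤ q) ≥ 1 - ε. -/
open MeasureTheory

/-- In a finite family of reals, at least `k` members have fewer than `k` members strictly
below them. -/
theorem le_card_filter_card_lt {ι : Type*} [Fintype ι] (v : ι → ℝ) {k : ℕ}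
    (hk : k ≤ Fintype.card ι) :
    k ≤ (Finset.univ.filter
      (fun j => (Finset.univ.filter (fun i => v i < v j)).card < k)).card := by
  classical
  by_cases h : ∃ j, k ≤ (Finset.univ.filter (fun i => v i < v j)).card
  · obtain ⟨j, hj, hmin⟩ := Finset.exists_min_image
      (Finset.univ.filter (fun j => k ≤ (Finset.univ.filter (fun i => v i < v j)).card)) v
      (by obtain ⟨j, hj⟩ := h; exact ⟨j, by simpa using hj⟩)
    simp only [Finset.mem_filter, Finset.mem_univ, true_and] at hj hmin
    refine hj.trans (Finset.card_le_card fun i hi => ?_)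
    simp only [Finset.mem_filter, Finset.mem_univ, true_and] at hi ⊢
    by_contra! hcon
    exact (hmin i hcon).not_gt hi
  · push Not at h
    rw [Finset.filter_true_of_mem fun j _ => h j]
    simpa using hk

theorem measurableSet_card_lt {ι : Type*} [Fintype ι] (j : ι) (k : ℕ) :
    MeasurableSet {v : ι → ℝ | (Finset.univ.filter (fun i => v i < v j)).card < k} := by
  simp_rw [Finset.card_filter]
  refine measurableSet_lt (Finset.measurable_sum _ fun i _ => ?_) measurable_const
  exact Measurable.ite (measurableSet_lt (measurable_pi_apply i) (measurable_pi_apply j))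
    measurable_const measurable_const

/-- For exchangeable variables, the probability that fewer than `k` of them lie strictly below a
given one is at least `k` divided by the number of variables. -/
theorem le_card_mul_measure_card_lt {Ω ι : Type*} [MeasurableSpace Ω] [Fintype ι]
    (P : Measure Ω) [IsProbabilityMeasure P] (V : ι → Ω → ℝ) (hmeas : ∀ i, Measurable (V i))
    (hexch : ∀ σ : Equiv.Perm ι,
      Measure.map (fun ω => fun i => V (σ i) ω) P = Measure.map (fun ω => fun i => V i ω) P)
    {k : ℕ} (hk : k ≤ Fintype.card ι) (l : ι) :
    (k : ENNReal) ≤ Fintype.card ι *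
      P {ω | (Finset.univ.filter (fun i => V i ω < V l ω)).card < k} := by
  classical
  set B : ι → Set Ω := fun j => {ω | (Finset.univ.filter (fun i => V i ω < V j ω)).card < k}
    with hB
  have hBm (j : ι) : MeasurableSet (B j) :=
    measurable_pi_lambda (fun ω i => V i ω) hmeas (measurableSet_card_lt j k)
  have hBeq (j : ι) : P (B j) = P (B l) := by
    have h := congrArg
      (fun μ => μ {v : ι → ℝ | (Finset.univ.filter (fun i => v i < v l)).card < k})
      (hexch (Equiv.swap j l))
    rw [Measure.map_apply (measurable_pi_lambda _ fun i => hmeas _) (measurableSet_card_lt l k),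
      Measure.map_apply (measurable_pi_lambda _ hmeas) (measurableSet_card_lt l k)] at h
    refine Eq.trans (congrArg P ?_) h
    ext ω
    simp only [hB, Set.mem_ofPred_eq, Set.mem_preimage, Equiv.swap_apply_right, Finset.card_filter]
    rw [Equiv.sum_comp (Equiv.swap j l) (fun i => if V i ω < V j ω then 1 else 0)]
  calc (k : ENNReal) = ∫⁻ _, (k : ENNReal) ∂P := by simp
    _ ≤ ∫⁻ ω, ∑ j, (B j).indicator 1 ω ∂P := by
        refine lintegral_mono fun ω => ?_
        have h := le_card_filter_card_lt (fun i => V i ω) hk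
        rw [Finset.card_filter] at h
        simp only [Set.indicator_apply, Pi.one_apply, hB, Set.mem_ofPred_eq]
        exact_mod_cast h
    _ = ∑ j, P (B j) := by
        rw [lintegral_finsetSum _ fun j _ => measurable_one.indicator (hBm j)]
        simp_rw [lintegral_indicator_one (hBm _)]
    _ = Fintype.card ι * P (B l) := by simp [hBeq]

/-- A number with fewer than `k ≤ n` of the values `w i` strictly below it is at most the `k`-th
smallest of these values. -/
theorem le_sInf_of_card_lt {ι : Type*} [Fintype ι] (w : ι → ℝ) {k : ℕ}
    (hk : k ≤ Fintype.card ι) {y : ℝ}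
    (hy : (Finset.univ.filter (fun i => w i < y)).card < k) :
    y ≤ sInf {x : ℝ | k ≤ (Finset.univ.filter (fun i => w i ≤ x)).card} := by
  refine le_csInf ?_ fun x hx => ?_
  · obtain ⟨b, hb⟩ := (Set.finite_range w).bddAbove
    refine ⟨b, ?_⟩
    rw [Set.mem_ofPred_eq, Finset.filter_true_of_mem fun i _ => hb ⟨i, rfl⟩]
    simpa using hk
  · by_contra! hlt
    have hsub : Finset.univ.filter (fun i => w i ≤ x) ⊆ Finset.univ.filter (fun i => w i < y) :=
      Finset.monotone_filter_right _ fun i _ hi => lt_of_le_of_lt hi hlt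
    exact (hx.trans (Finset.card_le_card hsub)).not_gt hy

/-- **Split conformal prediction.**  Let `V 0, …, V n` (indices in `Fin (n+1)`) be exchangeable
real-valued random variables, let `ε ∈ (0,1)`, and let `k = ⌈(1-ε)(n+1)⌉`.  Define the conformal
quantile `q` to be the `k`-th smallest value among the first `n` variables (equivalently, the
infimum of all `x` such that at least `k` of the first `n` values are `≤ x`), taken to be `+∞`
(so that the coverage event holds trivially) when `k > n`.  Then
`ℙ(V_{n+1} ≤ q) ≥ 1 - ε`. -/
theorem split_conformal_prediction
    {Ω : Type*} [MeasurableSpace Ω] (ℙ : Measure Ω) [IsProbabilityMeasure ℙ]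
    (n : ℕ) (V : Fin (n + 1) → Ω → ℝ)
    (hmeas : ∀ i, Measurable (V i))
    (hexch : ∀ σ : Equiv.Perm (Fin (n + 1)),
      Measure.map (fun ω => fun i => V (σ i) ω) ℙ
        = Measure.map (fun ω => fun i => V i ω) ℙ)
    (ε : ℝ) (hε : ε ∈ Set.Ioo (0 : ℝ) 1) :
    ENNReal.ofReal (1 - ε) ≤
      ℙ {ω | if ⌈(1 - ε) * ((n : ℝ) + 1)⌉₊ ≤ n then
          V (Fin.last n) ω ≤
            sInf {x : ℝ | ⌈(1 - ε) * ((n : ℝ) + 1)⌉₊ ≤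
              (Finset.univ.filter (fun i : Fin n => V i.castSucc ω ≤ x)).card}
        else True} := by
  obtain ⟨hε0, hε1⟩ := hε
  split_ifs with hkn
  · set k := ⌈(1 - ε) * ((n : ℝ) + 1)⌉₊ with hk
    have hcov := le_card_mul_measure_card_lt ℙ V hmeas hexch (k := k)
      (by simpa using hkn.trans n.le_succ) (Fin.last n)
    calc
      ENNReal.ofReal (1 - ε)
        ≤ ℙ {ω | (Finset.univ.filter (fun i => V i ω < V (Fin.last n) ω)).card < k} := ?_
      _ ≤ _ := measure_mono fun ω hω =>
        le_sInf_of_card_lt (fun i : Fin n => V i.castSucc ω) (by simpa using hkn) ?_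
    · have hle : ENNReal.ofReal (1 - ε) * (n + 1 : ℕ) ≤ k := by
        rw [← ENNReal.ofReal_natCast, ← ENNReal.ofReal_natCast,
          ← ENNReal.ofReal_mul (by linarith)]
        refine ENNReal.ofReal_le_ofReal ?_
        push_cast
        exact Nat.le_ceil _
      rw [Fintype.card_fin, mul_comm] at hcov
      exact (ENNReal.mul_le_mul_iff_left (by simp) (by finiteness)).1 (hle.trans hcov)
    · refine lt_of_le_of_lt ?_ hω
      rw [← Finset.card_map Fin.castSuccEmb]
      refine Finset.card_le_card fun i hi => ?_
      obtain ⟨j, hj, rfl⟩ := Finset.mem_map.1 hi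
      simpa using hj
  · simpa using hε0.le
end

section
/- Let X and Y be real-valued random variables with CDFs F_X and F_Y respectively, and suppose Y stochastically dominates X, i.e., F_X(u) ≥ F_Y(u) for all real u. Then the random variable Z = F_X(Y) is super-uniform: ℙ(F_X(Y) ≤ z) ≤ z for every z ∈ [0,1]. -/
open MeasureTheory

/-- A set of reals has measure at most `c` as soon as every ray `(-∞, u]` with `u` in the set
does, by inner regularity: a nonempty compact subset has a greatest element. -/
theorem measure_le_of_forall_measure_Iic_le (ν : Measure ℝ) [IsFiniteMeasure ν] {s : Set ℝ}
    (hs : MeasurableSet s) {c : ENNReal} (h : ∀ u ∈ s, ν (Set.Iic u) ≤ c) : ν s ≤ c := by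
  rw [hs.measure_eq_iSup_isCompact]
  refine iSup₂_le fun K hKs ↦ iSup_le fun hK ↦ ?_
  rcases K.eq_empty_or_nonempty with rfl | hne
  · simp
  · obtain ⟨u, hu⟩ := hK.exists_isGreatest hne
    exact (measure_mono fun x hx ↦ hu.2 hx).trans (h u (hKs hu.1))

/-- **Super-uniformity under stochastic dominance.**  Let `X` and `Y` be real-valued random
variables with CDFs `F_X` and `F_Y`, and suppose `Y` stochastically dominates `X`, i.e.
`F_X(u) ≥ F_Y(u)` for all real `u`.  Then `Z = F_X(Y)` is super-uniform:
`ℙ(F_X(Y) ≤ z) ≤ z` for every `z ∈ [0,1]`. -/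
theorem cdf_comp_dominating_superuniform
    {Ω : Type*} [MeasurableSpace Ω] (μ : Measure Ω) [IsProbabilityMeasure μ]
    (X Y : Ω → ℝ) (hX : Measurable X) (hY : Measurable Y)
    (hdom : ∀ u : ℝ, (μ {ω | Y ω ≤ u}).toReal ≤ (μ {ω | X ω ≤ u}).toReal) :
    ∀ z ∈ Set.Icc (0 : ℝ) 1,
      (μ {ω | (μ {ω' | X ω' ≤ Y ω}).toReal ≤ z}).toReal ≤ z := by
  intro z hz
  let s : Set ℝ := {u | (μ {ω | X ω ≤ u}).toReal ≤ z}
  have hs : MeasurableSet s := by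
    refine IsLowerSet.ordConnected (fun a b hba ha ↦ ?_) |>.measurableSet
    exact (measureReal_mono fun ω hω ↦ le_trans hω hba).trans ha
  have hY' : IsProbabilityMeasure (μ.map Y) := Measure.isProbabilityMeasure_map hY.aemeasurable
  have hle : μ.map Y s ≤ ENNReal.ofReal z := by
    refine measure_le_of_forall_measure_Iic_le _ hs fun u hu ↦ ?_
    rw [Measure.map_apply hY measurableSet_Iic]
    exact (ENNReal.le_ofReal_iff_toReal_le (measure_ne_top _ _) hz.1).2 ((hdom u).trans hu)
  rw [Measure.map_apply hY hs] at hle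
  exact ENNReal.toReal_le_of_le_ofReal hz.1 hle
end

section
/- Let Λ be a nonempty finite set, let r : Λ → ℝ be a fixed (risk) function, and fix ε ∈ ℝ and δ ∈ (0,1). For each λ ∈ Λ let p_λ be a [0,1]-valued random variable (all on a common probability space) such that p_λ is super-uniform whenever r(λ) > ε, i.e., ℙ(p_λ ≤ z) ≤ z for all z ∈ [0,1] for every λ with r(λ) > ε. Define the random set Λ_valid = {λ ∈ Λ : p_λ ≤ δ/|Λ|} (Bonferroni correction). Then ℙ(∃ λ ∈ Λ_valid with r(λ) > ε) ≤ δ; equivalently, ℙ(sup_{λ ∈ Λ_valid} r(λ) ≤ ε) ≥ 1 - δ. -/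
open MeasureTheory

/-- **Learn Then Test with Bonferroni correction (Theorem 2, instantiated).**
Let `Λ` be a nonempty finite set, `r : Λ → ℝ` a fixed risk function, `ε ∈ ℝ`, `δ ∈ (0,1)`.
For each `λ ∈ Λ`, let `p λ` be a `[0,1]`-valued random variable that is super-uniform whenever
`r λ > ε`.  Define `Λ_valid = {λ : p λ ≤ δ / |Λ|}` (Bonferroni).  Then
`ℙ(∃ λ ∈ Λ_valid, r λ > ε) ≤ δ`. -/
theorem ltt_bonferroni
    {Ω Λ : Type*} [MeasurableSpace Ω] (μ : Measure Ω) [IsProbabilityMeasure μ]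
    [Fintype Λ] [Nonempty Λ]
    (r : Λ → ℝ) (ε δ : ℝ) (hδ : δ ∈ Set.Ioo (0 : ℝ) 1)
    (p : Λ → Ω → ℝ) (hmeas : ∀ l, Measurable (p l))
    (hrange : ∀ l ω, p l ω ∈ Set.Icc (0 : ℝ) 1)
    (hsup : ∀ l, ε < r l → ∀ z ∈ Set.Icc (0 : ℝ) 1,
      (μ {ω | p l ω ≤ z}).toReal ≤ z) :
    (μ {ω | ∃ l, p l ω ≤ δ / (Fintype.card Λ : ℝ) ∧ ε < r l}).toReal ≤ δ := by
  have hcard : (1 : ℝ) ≤ Fintype.card Λ := by exact_mod_cast Fintype.card_pos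
  have hcard_pos : (0 : ℝ) < Fintype.card Λ := one_pos.trans_le hcard
  have hz_nonneg : 0 ≤ δ / (Fintype.card Λ : ℝ) := div_nonneg hδ.1.le hcard_pos.le
  have hz : δ / (Fintype.card Λ : ℝ) ∈ Set.Icc (0 : ℝ) 1 :=
    ⟨hz_nonneg, (div_le_self hδ.1.le hcard).trans hδ.2.le⟩
  have hunion : {ω | ∃ l, p l ω ≤ δ / (Fintype.card Λ : ℝ) ∧ ε < r l} =
      ⋃ l, {ω | p l ω ≤ δ / (Fintype.card Λ : ℝ) ∧ ε < r l} := by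
    ext ω
    simp
  rw [hunion]
  calc μ.real (⋃ l, {ω | p l ω ≤ δ / (Fintype.card Λ : ℝ) ∧ ε < r l})
      ≤ ∑ l, μ.real {ω | p l ω ≤ δ / (Fintype.card Λ : ℝ) ∧ ε < r l} :=
        measureReal_iUnion_fintype_le _
    _ ≤ ∑ _l : Λ, δ / (Fintype.card Λ : ℝ) := by
        refine Finset.sum_le_sum fun l _ => ?_
        by_cases hl : ε < r l
        · simpa [hl, Measure.real] using hsup l hl _ hz
        · simpa [hl] using hz_nonneg
    _ = δ := by
        rw [Finset.sum_const, Finset.card_univ, nsmul_eq_mul, mul_div_cancel₀ _ hcard_pos.ne']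
end
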